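/- arXiv:1501.00539 — 2 statements merged into one kernel-verified Lean document; each statement's English description precedes it below -/
import Mathlib

section
/- Let f₁, …, f_p be probability density functions on ℝⁿ, let q₁, …, q_p ≥ 0 sum to one, and let f = Σ_{ℓ=1}^p q_ℓ f_ℓ be the mixture density. If 0 < α < 1, then h_α(f) ≤ (1/(1−α)) · log p + max_{1 ≤ ℓ ≤ p} h_α(f_ℓ). -/
open MeasureTheory ENNReal Filter

noncomputable section

/-- `f` is a probability density (w.r.t. Lebesgue measure) on `ℝⁿ`. -/
def IsDensity {n : ℕ} (f : (Fin n → ℝ) → ℝ) : Prop :=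
  Measurable f ∧ (∀ x, 0 ≤ f x) ∧ ∫⁻ x, ENNReal.ofReal (f x) = 1

/-- `∫ f(x)^α dx`, as an extended nonnegative real. -/
def renyiIntegral {n : ℕ} (f : (Fin n → ℝ) → ℝ) (α : ℝ) : ℝ≥0∞ :=
  ∫⁻ x, ENNReal.ofReal (f x ^ α)

/-- Order-`α` Rényi entropy of a density on `ℝⁿ`: `(1/(1-α)) log ∫ f^α`, interpreted as `+∞`
if the integral diverges and `α < 1`, and as `-∞` if it diverges and `α > 1`. -/
def renyiEntropy {n : ℕ} (f : (Fin n → ℝ) → ℝ) (α : ℝ) : EReal :=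
  if renyiIntegral f α = ∞ then (if α < 1 then (⊤ : EReal) else (⊥ : EReal))
  else (((1 - α)⁻¹ * Real.log (renyiIntegral f α).toReal : ℝ) : EReal)

theorem IsDensity.mixture {n : ℕ} {ι : Type*} [Fintype ι] {f : ι → (Fin n → ℝ) → ℝ} {q : ι → ℝ}
    (hf : ∀ ℓ, IsDensity (f ℓ)) (hq : ∀ ℓ, 0 ≤ q ℓ) (hqsum : ∑ ℓ, q ℓ = 1) :
    IsDensity (fun x => ∑ ℓ, q ℓ * f ℓ x) := by
  refine ⟨Finset.measurable_sum _ fun ℓ _ => (hf ℓ).1.const_mul _,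
    fun x => Finset.sum_nonneg fun ℓ _ => mul_nonneg (hq ℓ) ((hf ℓ).2.1 x), ?_⟩
  calc ∫⁻ x, ENNReal.ofReal (∑ ℓ, q ℓ * f ℓ x)
      = ∫⁻ x, ∑ ℓ, ENNReal.ofReal (q ℓ) * ENNReal.ofReal (f ℓ x) := by
        refine lintegral_congr fun x => ?_
        rw [ENNReal.ofReal_sum_of_nonneg fun ℓ _ => mul_nonneg (hq ℓ) ((hf ℓ).2.1 x)]
        exact Finset.sum_congr rfl fun ℓ _ => ENNReal.ofReal_mul (hq ℓ)
    _ = ∑ ℓ, ENNReal.ofReal (q ℓ) := by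
        rw [lintegral_finsetSum _ fun ℓ _ => ((hf ℓ).1.ennreal_ofReal).const_mul _]
        refine Finset.sum_congr rfl fun ℓ _ => ?_
        rw [lintegral_const_mul _ (hf ℓ).1.ennreal_ofReal, (hf ℓ).2.2, mul_one]
    _ = 1 := by
        rw [← ENNReal.ofReal_sum_of_nonneg fun ℓ _ => hq ℓ, hqsum, ENNReal.ofReal_one]

theorem IsDensity.renyiIntegral_ne_zero {n : ℕ} {f : (Fin n → ℝ) → ℝ} (hf : IsDensity f)
    (α : ℝ) : renyiIntegral f α ≠ 0 := by
  intro h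
  rw [renyiIntegral, lintegral_eq_zero_iff (hf.1.pow_const α).ennreal_ofReal] at h
  have hzero : ∫⁻ x, ENNReal.ofReal (f x) = 0 := by
    rw [lintegral_eq_zero_iff hf.1.ennreal_ofReal]
    filter_upwards [h] with x hx
    simp only [Pi.zero_apply, ENNReal.ofReal_eq_zero] at hx ⊢
    by_contra! hpos
    exact absurd hx (Real.rpow_pos_of_pos hpos α).not_ge
  exact one_ne_zero (hf.2.2.symm.trans hzero)

theorem ENNReal.rpow_finsetSum_le_finsetSum_rpow {ι : Type*} (s : Finset ι) (a : ι → ℝ≥0∞)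
    {α : ℝ} (hα0 : 0 < α) (hα1 : α ≤ 1) : (∑ i ∈ s, a i) ^ α ≤ ∑ i ∈ s, a i ^ α :=
  Finset.le_sum_of_subadditive (fun x : ℝ≥0∞ => x ^ α) (ENNReal.zero_rpow_of_pos hα0).le
    (fun x y => ENNReal.rpow_add_le_add_rpow x y hα0.le hα1) s a

theorem renyiIntegral_mixture_le {n : ℕ} {ι : Type*} [Fintype ι] {f : ι → (Fin n → ℝ) → ℝ}
    {q : ι → ℝ} (hf : ∀ ℓ, IsDensity (f ℓ)) (hq : ∀ ℓ, 0 ≤ q ℓ) (hqsum : ∑ ℓ, q ℓ = 1)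
    {α : ℝ} (hα0 : 0 < α) (hα1 : α ≤ 1) :
    renyiIntegral (fun x => ∑ ℓ, q ℓ * f ℓ x) α ≤ ∑ ℓ, renyiIntegral (f ℓ) α := by
  have hq1 (ℓ : ι) : q ℓ ≤ 1 :=
    hqsum ▸ Finset.single_le_sum (fun i _ => hq i) (Finset.mem_univ ℓ)
  unfold renyiIntegral
  rw [← lintegral_finsetSum _ fun ℓ _ => ((hf ℓ).1.pow_const α).ennreal_ofReal]
  refine lintegral_mono fun x => ?_
  have hnonneg (ℓ : ι) : 0 ≤ q ℓ * f ℓ x := mul_nonneg (hq ℓ) ((hf ℓ).2.1 x)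
  calc ENNReal.ofReal ((∑ ℓ, q ℓ * f ℓ x) ^ α)
      = (∑ ℓ, ENNReal.ofReal (q ℓ * f ℓ x)) ^ α := by
        rw [← ENNReal.ofReal_rpow_of_nonneg (Finset.sum_nonneg fun ℓ _ => hnonneg ℓ) hα0.le,
          ENNReal.ofReal_sum_of_nonneg fun ℓ _ => hnonneg ℓ]
    _ ≤ ∑ ℓ, ENNReal.ofReal (q ℓ * f ℓ x) ^ α :=
        ENNReal.rpow_finsetSum_le_finsetSum_rpow _ _ hα0 hα1
    _ ≤ ∑ ℓ, ENNReal.ofReal (f ℓ x ^ α) := by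
        refine Finset.sum_le_sum fun ℓ _ => ?_
        rw [ENNReal.ofReal_rpow_of_nonneg (hnonneg ℓ) hα0.le]
        exact ENNReal.ofReal_le_ofReal (Real.rpow_le_rpow (hnonneg ℓ)
          (mul_le_of_le_one_left ((hf ℓ).2.1 x) (hq1 ℓ)) hα0.le)

/-- Lemma on mixtures, upper bound for `0 < α < 1`: if `f₁, …, f_p` are
densities on `ℝⁿ` and `q₁, …, q_p ≥ 0` sum to one, then for `0 < α < 1` the Rényi entropy of
the mixture is at most `(1/(1-α)) log p + max_ℓ h_α(f_ℓ)`. -/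
theorem renyi_mixture_upper_bound_alpha_lt_one
    (n p : ℕ) (f : Fin p → (Fin n → ℝ) → ℝ) (q : Fin p → ℝ)
    (hf : ∀ ℓ, IsDensity (f ℓ)) (hq : ∀ ℓ, 0 ≤ q ℓ) (hqsum : ∑ ℓ, q ℓ = 1)
    (α : ℝ) (hα0 : 0 < α) (hα1 : α < 1) :
    renyiEntropy (fun x => ∑ ℓ, q ℓ * f ℓ x) α ≤
      (((1 - α)⁻¹ * Real.log p : ℝ) : EReal) + ⨆ ℓ, renyiEntropy (f ℓ) α := by
  have hp : p ≠ 0 := by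
    rintro rfl
    simp at hqsum
  have : NeZero p := ⟨hp⟩
  obtain ⟨m, hm⟩ := Finite.exists_max fun ℓ => renyiIntegral (f ℓ) α
  refine le_trans ?_ (add_le_add le_rfl (le_iSup (fun ℓ => renyiEntropy (f ℓ) α) m))
  by_cases htop : renyiIntegral (f m) α = ∞
  · rw [renyiEntropy.eq_def (f m), if_pos htop, if_pos hα1, EReal.coe_add_top]
    exact le_top
  have hle : renyiIntegral (fun x => ∑ ℓ, q ℓ * f ℓ x) α ≤ p * renyiIntegral (f m) α :=
    calc renyiIntegral (fun x => ∑ ℓ, q ℓ * f ℓ x) α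
        ≤ ∑ ℓ, renyiIntegral (f ℓ) α := renyiIntegral_mixture_le hf hq hqsum hα0 hα1.le
      _ ≤ ∑ _ℓ : Fin p, renyiIntegral (f m) α := Finset.sum_le_sum fun ℓ _ => hm ℓ
      _ = p * renyiIntegral (f m) α := by simp
  have hfin : (p : ℝ≥0∞) * renyiIntegral (f m) α ≠ ∞ :=
    ENNReal.mul_ne_top (ENNReal.natCast_ne_top p) htop
  have hmix := ne_top_of_le_ne_top hfin hle
  have hlog := Real.log_le_log
    (ENNReal.toReal_pos ((IsDensity.mixture hf hq hqsum).renyiIntegral_ne_zero α) hmix)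
    (ENNReal.toReal_mono hfin hle)
  rw [ENNReal.toReal_mul, ENNReal.toReal_natCast, Real.log_mul (Nat.cast_ne_zero.mpr hp)
    (ENNReal.toReal_pos ((hf m).renyiIntegral_ne_zero α) htop).ne'] at hlog
  rw [renyiEntropy, renyiEntropy, if_neg hmix, if_neg htop, ← EReal.coe_add, EReal.coe_le_coe_iff,
    ← mul_add]
  exact mul_le_mul_of_nonneg_left hlog (inv_nonneg.mpr (sub_nonneg.mpr hα1.le))
end
end

section
/- Let S ⊆ ℝ be measurable, r : ℝ → ℝ measurable, and suppose Assumption (A) holds with constant Γ₀. Then for every Γ ∈ (Γ₀, ∞) and every δ > 0 there exists a bounded probability density f* supported by S such that ∫ f*(x)·r(x) dx < Γ + δ and h(f*) > h*(Γ) − δ. -/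
open MeasureTheory ENNReal Filter

noncomputable section

/-- `f` is a probability density (w.r.t. Lebesgue measure) on `ℝ`. -/
def IsDensity1 (f : ℝ → ℝ) : Prop :=
  Measurable f ∧ (∀ x, 0 ≤ f x) ∧ ∫⁻ x, ENNReal.ofReal (f x) = 1

/-- `∫ (f log f)⁺`, the positive part of `∫ f log f`. -/
def shannonNegPart (f : ℝ → ℝ) : ℝ≥0∞ := ∫⁻ x, ENNReal.ofReal (f x * Real.log (f x))

/-- `∫ (f log f)⁻`, the negative part of `∫ f log f`. -/
def shannonPosPart (f : ℝ → ℝ) : ℝ≥0∞ := ∫⁻ x, ENNReal.ofReal (-(f x * Real.log (f x)))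

/-- The differential Shannon entropy `-∫ f log f` is defined (possibly `±∞`): the positive
and negative parts of the integral are not both infinite. -/
def ShannonDefined (f : ℝ → ℝ) : Prop := shannonPosPart f ≠ ∞ ∨ shannonNegPart f ≠ ∞

/-- Differential Shannon entropy `-∫ f log f`, as an extended real. -/
def shannonEntropy (f : ℝ → ℝ) : EReal :=
  (shannonPosPart f : EReal) - (shannonNegPart f : EReal)

/-- `∫ f(x) r(x) dx ≤ Γ`: the positive part of the integral is finite and the integral,
with values in the extended reals (possibly `-∞`), is at most `Γ`. -/
def CostLE (f r : ℝ → ℝ) (Γ : ℝ) : Prop :=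
  (∫⁻ x, ENNReal.ofReal (f x * r x)) ≠ ∞ ∧
  ((∫⁻ x, ENNReal.ofReal (f x * r x) : ℝ≥0∞) : EReal)
      - ((∫⁻ x, ENNReal.ofReal (-(f x * r x)) : ℝ≥0∞) : EReal) ≤ (Γ : EReal)

/-- `h⋆(Γ)`: the supremum of the Shannon entropy `h(f)` over all densities `f` supported by
`S` with `∫ f·r ≤ Γ` (and with `h(f)` defined); it is `⊥` if no such density exists. -/
def hStar (S : Set ℝ) (r : ℝ → ℝ) (Γ : ℝ) : EReal :=
  sSup {h : EReal | ∃ f : ℝ → ℝ, IsDensity1 f ∧ (∀ x ∉ S, f x = 0) ∧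
    ShannonDefined f ∧ CostLE f r Γ ∧ h = shannonEntropy f}

/-- A function whose positive and negative parts have finite integrals is integrable. -/
lemma integrable_of_lintegral_ofReal_ne_top {α : Type*} [MeasurableSpace α] {μ : Measure α}
    {u : α → ℝ} (hu : Measurable u) (hpos : ∫⁻ x, ENNReal.ofReal (u x) ∂μ ≠ ∞)
    (hneg : ∫⁻ x, ENNReal.ofReal (-u x) ∂μ ≠ ∞) : Integrable u μ := by
  refine ⟨hu.aestronglyMeasurable, ?_⟩
  have hle : ∫⁻ x, ‖u x‖ₑ ∂μ ≤
      ∫⁻ x, ENNReal.ofReal (u x) ∂μ + ∫⁻ x, ENNReal.ofReal (-u x) ∂μ := by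
    rw [← lintegral_add_left hu.ennreal_ofReal]
    refine lintegral_mono fun x => ?_
    rw [Real.enorm_eq_ofReal_abs]
    rcases le_total 0 (u x) with h | h
    · rw [abs_of_nonneg h]
      exact le_self_add
    · rw [abs_of_nonpos h]
      exact le_add_self
  exact hle.trans_lt (ENNReal.add_lt_top.2 ⟨hpos.lt_top, hneg.lt_top⟩)

lemma tendsto_setLIntegral_of_monotone {α : Type*} [MeasurableSpace α] {μ : Measure α}
    {A : ℕ → Set α} (hA : Monotone A) (hAU : ⋃ n, A n = Set.univ) (v : α → ℝ≥0∞) :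
    Tendsto (fun n => ∫⁻ x in A n, v x ∂μ) atTop (nhds (∫⁻ x, v x ∂μ)) := by
  have h := setLIntegral_iUnion_of_directed (μ := μ) v hA.directed_le
  rw [hAU, Measure.restrict_univ] at h
  rw [h]
  exact tendsto_atTop_iSup fun m n hmn => lintegral_mono_set (hA hmn)

lemma lintegral_ofReal_mul_indicator {α : Type*} [MeasurableSpace α] {μ : Measure α}
    {A : Set α} (hA : MeasurableSet A) {a : ℝ} (ha : 0 ≤ a) (u : α → ℝ) :
    ∫⁻ x, ENNReal.ofReal (a * A.indicator u x) ∂μ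
      = ENNReal.ofReal a * ∫⁻ x in A, ENNReal.ofReal (u x) ∂μ := by
  rw [← lintegral_indicator hA, ← lintegral_const_mul' _ _ ENNReal.ofReal_ne_top]
  refine lintegral_congr fun x => ?_
  rw [ENNReal.ofReal_mul ha]
  by_cases hx : x ∈ A <;> simp [hx]

lemma tendsto_lintegral_ofReal_mul_indicator {α : Type*} [MeasurableSpace α] {μ : Measure α}
    {A : ℕ → Set α} (hAm : ∀ n, MeasurableSet (A n)) (hA : Monotone A)
    (hAU : ⋃ n, A n = Set.univ) {a : ℕ → ℝ} (ha : ∀ n, 0 ≤ a n)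
    (ha1 : Tendsto a atTop (nhds 1)) (u : α → ℝ) :
    Tendsto (fun n => ∫⁻ x, ENNReal.ofReal (a n * (A n).indicator u x) ∂μ) atTop
      (nhds (∫⁻ x, ENNReal.ofReal (u x) ∂μ)) := by
  simp_rw [fun n => lintegral_ofReal_mul_indicator (μ := μ) (hAm n) (ha n) u]
  have h := ENNReal.Tendsto.mul (ENNReal.tendsto_ofReal ha1) (by simp)
    (tendsto_setLIntegral_of_monotone (μ := μ) hA hAU fun x => ENNReal.ofReal (u x)) (by simp)
  simpa using h

lemma ShannonDefined.parts_ne_top {f : ℝ → ℝ} (hd : ShannonDefined f)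
    (hbot : shannonEntropy f ≠ ⊥) (htop : shannonEntropy f ≠ ⊤) :
    shannonPosPart f ≠ ∞ ∧ shannonNegPart f ≠ ∞ := by
  unfold shannonEntropy at hbot htop
  refine ⟨fun hp => ?_, fun hn => ?_⟩
  · have hn : shannonNegPart f ≠ ∞ := hd.resolve_left (not_not.2 hp)
    lift shannonNegPart f to NNReal using hn with b
    rw [hp] at htop
    exact htop (EReal.top_sub_coe (b : ℝ))
  · have hp : shannonPosPart f ≠ ∞ := hd.resolve_right (not_not.2 hn)
    rw [hn] at hbot
    exact hbot (EReal.sub_top _)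

lemma shannonDefined_of_integrable {f : ℝ → ℝ}
    (hf : Integrable fun x => f x * Real.log (f x)) : ShannonDefined f :=
  .inr hf.lintegral_lt_top.ne

lemma shannonEntropy_of_integrable {f : ℝ → ℝ}
    (hf : Integrable fun x => f x * Real.log (f x)) :
    shannonEntropy f = ((-∫ x, f x * Real.log (f x) : ℝ) : EReal) := by
  have hN : shannonNegPart f ≠ ∞ := hf.lintegral_lt_top.ne
  have hP : shannonPosPart f ≠ ∞ := hf.neg.lintegral_lt_top.ne
  rw [integral_eq_lintegral_pos_part_sub_lintegral_neg_part hf, neg_sub]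
  change _ = (((shannonPosPart f).toReal - (shannonNegPart f).toReal : ℝ) : EReal)
  rw [EReal.coe_sub, EReal.coe_ennreal_toReal hP, EReal.coe_ennreal_toReal hN]
  rfl

lemma IsDensity1.integrable {f : ℝ → ℝ} (hf : IsDensity1 f) : Integrable f :=
  ⟨hf.1.aestronglyMeasurable, by
    rw [hasFiniteIntegral_iff_ofReal (ae_of_all _ hf.2.1), hf.2.2]
    exact ENNReal.one_lt_top⟩

lemma IsDensity1.integral_eq_one {f : ℝ → ℝ} (hf : IsDensity1 f) : ∫ x, f x = 1 := by
  rw [integral_eq_lintegral_of_nonneg_ae (ae_of_all _ hf.2.1) hf.1.aestronglyMeasurable, hf.2.2,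
    ENNReal.toReal_one]

/-- The restriction of `f` to `A`, normalized to have integral one. -/
def condDensity (f : ℝ → ℝ) (A : Set ℝ) (x : ℝ) : ℝ := (∫ y in A, f y)⁻¹ * A.indicator f x

lemma IsDensity1.condDensity {f : ℝ → ℝ} (hf : IsDensity1 f) {A : Set ℝ} (hA : MeasurableSet A)
    (hc : 0 < ∫ y in A, f y) : IsDensity1 (condDensity f A) := by
  refine ⟨(hf.1.indicator hA).const_mul _, fun x => mul_nonneg (inv_nonneg.2 hc.le)
    (Set.indicator_nonneg (fun y _ => hf.2.1 y) x), ?_⟩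
  unfold _root_.condDensity
  rw [lintegral_ofReal_mul_indicator hA (inv_nonneg.2 hc.le),
    ← ofReal_integral_eq_lintegral_ofReal hf.integrable.integrableOn (ae_of_all _ hf.2.1),
    ← ENNReal.ofReal_mul (inv_nonneg.2 hc.le), inv_mul_cancel₀ hc.ne', ENNReal.ofReal_one]

lemma condDensity_mul (f r : ℝ → ℝ) (A : Set ℝ) (x : ℝ) :
    condDensity f A x * r x = (∫ y in A, f y)⁻¹ * A.indicator (fun y => f y * r y) x := by
  by_cases hx : x ∈ A <;> simp [condDensity, hx, mul_assoc]

lemma condDensity_mul_log {f : ℝ → ℝ} {A : Set ℝ} (hc : 0 < ∫ y in A, f y) (x : ℝ) :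
    condDensity f A x * Real.log (condDensity f A x)
      = (∫ y in A, f y)⁻¹ * (A.indicator (fun y => f y * Real.log (f y)) x
          - Real.log (∫ y in A, f y) * A.indicator f x) := by
  by_cases hx : x ∈ A
  · rcases eq_or_ne (f x) 0 with h0 | h0
    · simp [condDensity, h0, hx]
    · simp only [condDensity, hx, Set.indicator_of_mem]
      rw [Real.log_mul (inv_ne_zero hc.ne') h0, Real.log_inv]
      ring
  · simp [condDensity, hx]

lemma integrable_condDensity_mul_log {f : ℝ → ℝ} (hf : Integrable f)
    (hL : Integrable fun x => f x * Real.log (f x)) {A : Set ℝ} (hA : MeasurableSet A)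
    (hc : 0 < ∫ y in A, f y) :
    Integrable fun x => condDensity f A x * Real.log (condDensity f A x) := by
  simp_rw [condDensity_mul_log hc]
  exact ((hL.indicator hA).sub ((hf.indicator hA).const_mul _)).const_mul _

lemma integral_condDensity_mul_log {f : ℝ → ℝ} (hf : Integrable f)
    (hL : Integrable fun x => f x * Real.log (f x)) {A : Set ℝ} (hA : MeasurableSet A)
    (hc : 0 < ∫ y in A, f y) :
    ∫ x, condDensity f A x * Real.log (condDensity f A x)
      = (∫ y in A, f y)⁻¹ * ((∫ x in A, f x * Real.log (f x))
          - Real.log (∫ y in A, f y) * ∫ y in A, f y) := by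
  simp_rw [condDensity_mul_log hc]
  rw [integral_const_mul, integral_sub (hL.indicator hA) ((hf.indicator hA).const_mul _),
    integral_const_mul, integral_indicator hA, integral_indicator hA]

lemma tendsto_setIntegral_univ {u : ℝ → ℝ} (hu : Integrable u) {A : ℕ → Set ℝ}
    (hAm : ∀ n, MeasurableSet (A n)) (hA : Monotone A) (hAU : ⋃ n, A n = Set.univ) :
    Tendsto (fun n => ∫ x in A n, u x) atTop (nhds (∫ x, u x)) := by
  simpa [hAU] using tendsto_setIntegral_of_monotone hAm hA hu.integrableOn

lemma tendsto_shannonEntropy_condDensity {f : ℝ → ℝ} (hf : IsDensity1 f)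
    (hL : Integrable fun x => f x * Real.log (f x)) {A : ℕ → Set ℝ}
    (hAm : ∀ n, MeasurableSet (A n)) (hA : Monotone A) (hAU : ⋃ n, A n = Set.univ) :
    Tendsto (fun n => shannonEntropy (condDensity f (A n))) atTop (nhds (shannonEntropy f)) := by
  have hc : Tendsto (fun n => ∫ x in A n, f x) atTop (nhds 1) :=
    hf.integral_eq_one ▸ tendsto_setIntegral_univ hf.integrable hAm hA hAU
  have hlog := hc.log one_ne_zero
  have hlim := ((hc.inv₀ one_ne_zero).mul
    ((tendsto_setIntegral_univ hL hAm hA hAU).sub (hlog.mul hc))).neg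
  simp only [inv_one, Real.log_one, zero_mul, sub_zero, one_mul] at hlim
  rw [shannonEntropy_of_integrable hL]
  refine (EReal.tendsto_coe.2 hlim).congr' ?_
  filter_upwards [hc.eventually_const_lt one_pos] with n hn
  rw [shannonEntropy_of_integrable (integrable_condDensity_mul_log hf.integrable hL (hAm n) hn),
    integral_condDensity_mul_log hf.integrable hL (hAm n) hn]

lemma tendsto_cost_condDensity {f r : ℝ → ℝ} (hf : IsDensity1 f)
    (hP : ∫⁻ x, ENNReal.ofReal (f x * r x) ≠ ∞) {A : ℕ → Set ℝ}
    (hAm : ∀ n, MeasurableSet (A n)) (hA : Monotone A) (hAU : ⋃ n, A n = Set.univ) :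
    Tendsto (fun n => ((∫⁻ x, ENNReal.ofReal (condDensity f (A n) x * r x) : ℝ≥0∞) : EReal)
        - ((∫⁻ x, ENNReal.ofReal (-(condDensity f (A n) x * r x)) : ℝ≥0∞) : EReal)) atTop
      (nhds (((∫⁻ x, ENNReal.ofReal (f x * r x) : ℝ≥0∞) : EReal)
        - ((∫⁻ x, ENNReal.ofReal (-(f x * r x)) : ℝ≥0∞) : EReal))) := by
  have hc : Tendsto (fun n => (∫ x in A n, f x)⁻¹) atTop (nhds 1) := by
    have h := hf.integral_eq_one ▸ tendsto_setIntegral_univ hf.integrable hAm hA hAU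
    simpa using h.inv₀ one_ne_zero
  have hc0 (n : ℕ) : 0 ≤ (∫ x in A n, f x)⁻¹ := inv_nonneg.2 (integral_nonneg hf.2.1)
  have hpos := tendsto_lintegral_ofReal_mul_indicator (μ := volume) hAm hA hAU hc0 hc
    fun x => f x * r x
  have hneg := tendsto_lintegral_ofReal_mul_indicator (μ := volume) hAm hA hAU hc0 hc
    fun x => -(f x * r x)
  have hr (n : ℕ) (x : ℝ) : -(condDensity f (A n) x * r x)
      = (∫ y in A n, f y)⁻¹ * (A n).indicator (fun y => -(f y * r y)) x := by
    rw [condDensity_mul, ← mul_neg]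
    by_cases hx : x ∈ A n <;> simp [hx]
  simp_rw [hr, condDensity_mul, sub_eq_add_neg]
  have hcont := EReal.continuousAt_add
    (p := (((∫⁻ x, ENNReal.ofReal (f x * r x) : ℝ≥0∞) : EReal),
      -((∫⁻ x, ENNReal.ofReal (-(f x * r x)) : ℝ≥0∞) : EReal)))
    (.inl (by simpa using hP)) (.inl (by simp))
  exact hcont.tendsto.comp ((EReal.tendsto_coe_ennreal.2 hpos).prodMk_nhds
    (EReal.tendsto_coe_ennreal.2 hneg).neg)

/-- Proposition 4: under Assumption (A) with constant `Γ₀`, for every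
`Γ > Γ₀` and every `δ > 0` there is a bounded density `f⋆` supported by `S` with
`∫ f⋆·r < Γ + δ` and `h(f⋆) > h⋆(Γ) - δ`. -/
theorem hStar_approached_by_bounded_densities
    (S : Set ℝ) (hS : MeasurableSet S) (r : ℝ → ℝ) (hr : Measurable r)
    (Γ₀ : ℝ) (hA1 : (⊥ : EReal) < hStar S r Γ₀) (hA2 : ∀ Γ' ≥ Γ₀, hStar S r Γ' < ⊤)
    (Γ : ℝ) (hΓ : Γ₀ < Γ) (δ : ℝ) (hδ : 0 < δ) :
    ∃ fstar : ℝ → ℝ, IsDensity1 fstar ∧ (∃ M : ℝ, ∀ x, fstar x ≤ M) ∧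
      (∀ x ∉ S, fstar x = 0) ∧
      ((∫⁻ x, ENNReal.ofReal (fstar x * r x)) ≠ ∞ ∧
        ((∫⁻ x, ENNReal.ofReal (fstar x * r x) : ℝ≥0∞) : EReal)
          - ((∫⁻ x, ENNReal.ofReal (-(fstar x * r x)) : ℝ≥0∞) : EReal) < ((Γ + δ : ℝ) : EReal)) ∧
      ShannonDefined fstar ∧
      hStar S r Γ - (δ : EReal) < shannonEntropy fstar := by
  have hbot : hStar S r Γ ≠ ⊥ := by
    refine (hA1.trans_le (sSup_le_sSup ?_)).ne'
    rintro _ ⟨f, hf, hfS, hd, hcost, rfl⟩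
    exact ⟨f, hf, hfS, hd, ⟨hcost.1, hcost.2.trans (EReal.coe_le_coe_iff.2 hΓ.le)⟩, rfl⟩
  have htop : hStar S r Γ < ⊤ := hA2 Γ hΓ.le
  have hlt : hStar S r Γ - (δ : EReal) < hStar S r Γ := by
    lift hStar S r Γ to ℝ using ⟨htop.ne, hbot⟩ with a
    exact_mod_cast sub_lt_self a hδ
  obtain ⟨_, ⟨f, hf, hfS, hd, hcost, rfl⟩, hfh⟩ := lt_sSup_iff.1 hlt
  have hfle : shannonEntropy f ≤ hStar S r Γ := le_sSup ⟨f, hf, hfS, hd, hcost, rfl⟩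
  obtain ⟨hpos, hneg⟩ := hd.parts_ne_top hfh.ne_bot (hfle.trans_lt htop).ne
  have hL : Integrable fun x => f x * Real.log (f x) :=
    integrable_of_lintegral_ofReal_ne_top (hf.1.mul hf.1.log) hneg hpos
  let A : ℕ → Set ℝ := fun n => {x | f x ≤ n}
  have hAm (n : ℕ) : MeasurableSet (A n) := measurableSet_le hf.1 measurable_const
  have hA : Monotone A := fun m n hmn x (hx : f x ≤ m) =>
    show f x ≤ n from hx.trans (Nat.cast_le.2 hmn)
  have hAU : ⋃ n, A n = Set.univ :=
    Set.eq_univ_of_forall fun x => Set.mem_iUnion.2 (exists_nat_ge (f x))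
  have hc : Tendsto (fun n => ∫ x in A n, f x) atTop (nhds 1) :=
    hf.integral_eq_one ▸ tendsto_setIntegral_univ hf.integrable hAm hA hAU
  have hΓδ : ((∫⁻ x, ENNReal.ofReal (f x * r x) : ℝ≥0∞) : EReal)
      - ((∫⁻ x, ENNReal.ofReal (-(f x * r x)) : ℝ≥0∞) : EReal) < ((Γ + δ : ℝ) : EReal) :=
    hcost.2.trans_lt (EReal.coe_lt_coe_iff.2 (lt_add_of_pos_right Γ hδ))
  obtain ⟨n, hn, hent, hlt⟩ := ((hc.eventually_const_lt one_pos).and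
    (((tendsto_shannonEntropy_condDensity hf hL hAm hA hAU).eventually_const_lt hfh).and
      ((tendsto_cost_condDensity hf hcost.1 hAm hA hAU).eventually_lt_const hΓδ))).exists
  refine ⟨condDensity f (A n), hf.condDensity (hAm n) hn, ⟨(∫ y in A n, f y)⁻¹ * n, fun x => ?_⟩,
    fun x hx => ?_, ⟨?_, hlt⟩, shannonDefined_of_integrable
      (integrable_condDensity_mul_log hf.integrable hL (hAm n) hn), hent⟩
  · refine mul_le_mul_of_nonneg_left ?_ (inv_nonneg.2 hn.le)
    exact Set.indicator_le' (fun y hy => hy) (fun _ _ => n.cast_nonneg) x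
  · simp [condDensity, Set.indicator_apply, hfS x hx]
  · simp_rw [condDensity_mul]
    rw [lintegral_ofReal_mul_indicator (hAm n) (inv_nonneg.2 hn.le)]
    exact ENNReal.mul_ne_top ENNReal.ofReal_ne_top
      (ne_top_of_le_ne_top hcost.1 (setLIntegral_le_lintegral _ _))
end
end
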